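/- arXiv:2410.14889 — 2 statements merged into one kernel-verified Lean document; each statement's English description precedes it below -/
import Mathlib

section
/- (Douglas factorization of even perturbations.) Let H be a separable Hilbert space over 𝔽 = ℝ or ℂ, let P be a bounded positive operator on H, and let K be a bounded operator on H. Then both P + K and P − K are positive if and only if K = √P ∘ X ∘ √P for some bounded self-adjoint operator X on H with ‖X‖ ≤ 1 and with the range of X contained in the closure of the range of P. -/
noncomputable section

open ContinuousLinearMap in
/-- If `‖A x‖ ≤ c ‖B x‖` for all `x`, then `A` factors through `B` by an operator of norm at most
`c` which absorbs the orthogonal projection onto the closure of the range of `B`. -/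
theorem ContinuousLinearMap.exists_comp_eq_of_norm_le {𝕜 E F G : Type*} [RCLike 𝕜]
    [NormedAddCommGroup E] [InnerProductSpace 𝕜 E]
    [NormedAddCommGroup F] [InnerProductSpace 𝕜 F] [CompleteSpace F]
    [NormedAddCommGroup G] [InnerProductSpace 𝕜 G] [CompleteSpace G]
    (A : E →L[𝕜] F) (B : E →L[𝕜] G) {c : ℝ} (hc : 0 ≤ c) (h : ∀ x, ‖A x‖ ≤ c * ‖B x‖) :
    ∃ C : G →L[𝕜] F, ‖C‖ ≤ c ∧ C ∘L B = A ∧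
      C ∘L B.range.topologicalClosure.starProjection = C := by
  set M := B.range.topologicalClosure
  have hBM : ∀ x, B x ∈ M := fun x ↦ B.range.le_topologicalClosure ⟨x, rfl⟩
  let e : E →ₗ[𝕜] M := B.toLinearMap.codRestrict M hBM
  have hd : DenseRange e := by
    rw [DenseRange, Subtype.dense_iff]
    intro y hy
    have hy' : y ∈ closure (Set.range B) := hy
    refine closure_mono ?_ hy'
    rintro _ ⟨x, rfl⟩
    exact ⟨e x, ⟨x, rfl⟩, rfl⟩
  have hn : ∀ x, ‖A.toLinearMap x‖ ≤ c * ‖e x‖ := h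
  have hP : ∀ x, M.orthogonalProjectionOnto (B x) = e x := fun x ↦
    M.orthogonalProjectionOnto_mem_subspace_eq_self (e x)
  refine ⟨A.toLinearMap.extendOfNorm e ∘L M.orthogonalProjectionOnto, ?_, ?_, ?_⟩
  · refine opNorm_le_bound _ hc fun x ↦ ?_
    refine (LinearMap.norm_extendOfNorm_apply_le hd c hn _).trans ?_
    exact mul_le_mul_of_nonneg_left (M.norm_orthogonalProjectionOnto_apply_le x) hc
  · ext x
    simp only [comp_apply, hP]
    exact LinearMap.extendOfNorm_eq hd ⟨c, hn⟩ x
  · ext x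
    have hx : M.orthogonalProjectionOnto (M.starProjection x) = M.orthogonalProjectionOnto x :=
      M.orthogonalProjectionOnto_mem_subspace_eq_self _
    exact congrArg (A.toLinearMap.extendOfNorm e) hx

/-- Cauchy–Schwarz inequality for a symmetric form dominated by `‖S ·‖ ^ 2`. -/
theorem ContinuousLinearMap.re_inner_le_of_isPositive_add_sub {𝕜 H : Type*} [RCLike 𝕜]
    [NormedAddCommGroup H] [InnerProductSpace 𝕜 H] {K S : H →L[𝕜] H}
    (hS : S.IsPositive) (hadd : (S ∘L S + K).IsPositive) (hsub : (S ∘L S - K).IsPositive)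
    (x y : H) : RCLike.re (inner 𝕜 (K x) y) ≤ ‖S x‖ * ‖S y‖ := by
  have hKsymm : RCLike.re (inner 𝕜 (K y) x) = RCLike.re (inner 𝕜 (K x) y) := by
    have h1 := congrArg RCLike.re (hadd.inner_left_eq_inner_right y x)
    have h2 := congrArg RCLike.re (hsub.inner_left_eq_inner_right y x)
    simp only [add_apply, sub_apply, inner_add_left, inner_add_right, inner_sub_left,
      inner_sub_right, map_add, map_sub] at h1 h2
    linarith [inner_re_symm (𝕜 := 𝕜) (K x) y]
  have hSS : ∀ u, RCLike.re (inner 𝕜 (S (S u)) u) = ‖S u‖ ^ 2 := fun u ↦ by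
    rw [hS.inner_left_eq_inner_right, inner_self_eq_norm_sq]
  have key : ∀ t : ℝ, 0 ≤ ‖S y‖ ^ 2 * (t * t) +
      (-2 * RCLike.re (inner 𝕜 (K x) y)) * t + ‖S x‖ ^ 2 := fun t ↦ by
    have h1 := hadd.re_inner_nonneg_left (x - (t : 𝕜) • y)
    have h2 := hsub.re_inner_nonneg_left (x + (t : 𝕜) • y)
    simp only [add_apply, sub_apply, comp_apply, map_add, map_sub, map_smul, inner_add_left,
      inner_add_right, inner_sub_left, inner_sub_right, inner_smul_left, inner_smul_right,
      RCLike.conj_ofReal, RCLike.re_ofReal_mul, hSS, hKsymm] at h1 h2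
    linarith
  have hd := discrim_le_zero key
  rw [discrim] at hd
  exact (abs_le_of_sq_le_sq' (by nlinarith) (by positivity)).2

open ContinuousLinearMap in
/-- A positive operator and its square have ranges with the same closure: the nontrivial inclusion. -/
theorem ContinuousLinearMap.IsPositive.mem_closure_range_comp_self {𝕜 H : Type*} [RCLike 𝕜]
    [NormedAddCommGroup H] [InnerProductSpace 𝕜 H] [CompleteSpace H] {S : H →L[𝕜] H}
    (hS : S.IsPositive) (x : H) : S x ∈ (S ∘L S).range.topologicalClosure := by
  rw [← Submodule.orthogonal_orthogonal_eq_closure, Submodule.mem_orthogonal]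
  intro v hv
  have hv' : S (S v) = 0 := by
    rw [← inner_self_eq_zero (𝕜 := 𝕜), hS.inner_left_eq_inner_right,
      ← hS.inner_left_eq_inner_right]
    have := (Submodule.mem_orthogonal _ _).1 hv (S (S (S (S v)))) ⟨S (S v), rfl⟩
    rw [hS.inner_left_eq_inner_right, hS.inner_left_eq_inner_right] at this
    simpa using this
  have hv'' : S v = 0 := by
    rw [← inner_self_eq_zero (𝕜 := 𝕜), hS.inner_left_eq_inner_right, hv', inner_zero_right]
  rw [← hS.inner_left_eq_inner_right, hv'', inner_zero_left]

open ContinuousLinearMap in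
/-- If `S ^ 2 ± K` are positive then `K` factors as `S Y S` with `‖Y‖ ≤ 1`. -/
theorem ContinuousLinearMap.exists_eq_comp_comp_of_isPositive_add_sub {𝕜 H : Type*} [RCLike 𝕜]
    [NormedAddCommGroup H] [InnerProductSpace 𝕜 H] [CompleteSpace H] {K S : H →L[𝕜] H}
    (hS : S.IsPositive) (hadd : (S ∘L S + K).IsPositive) (hsub : (S ∘L S - K).IsPositive) :
    ∃ Y : H →L[𝕜] H, ‖Y‖ ≤ 1 ∧ K = S ∘L Y ∘L S := by
  have hle := re_inner_le_of_isPositive_add_sub hS hadd hsub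
  have hKS : ∀ x, ‖K x‖ ≤ ‖S‖ * ‖S x‖ := fun x ↦ by
    have h1 := hle x (K x)
    rw [inner_self_eq_norm_sq] at h1
    have h2 := mul_le_mul_of_nonneg_left (S.le_opNorm (K x)) (norm_nonneg (S x))
    rcases (norm_nonneg (K x)).eq_or_lt with h0 | h0
    · rw [← h0]; positivity
    · exact le_of_mul_le_mul_right (by nlinarith) h0
  obtain ⟨C, -, hCS, hCQ⟩ := exists_comp_eq_of_norm_le K S (norm_nonneg S) hKS
  have hC : ∀ u ∈ S.range.topologicalClosure, ∀ y,
      RCLike.re (inner 𝕜 (C u) y) ≤ ‖u‖ * ‖S y‖ := by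
    intro u hu y
    refine closure_minimal (t := {u | RCLike.re (inner 𝕜 (C u) y) ≤ ‖u‖ * ‖S y‖}) ?_
      (isClosed_le (by fun_prop) (by fun_prop)) hu
    rintro _ ⟨x, rfl⟩
    have := hle x y
    rwa [← hCS] at this
  have hCadj : ∀ y, ‖(adjoint C) y‖ ≤ 1 * ‖S y‖ := fun y ↦ by
    set u := adjoint C y with hu
    have h1 := hC _ (S.range.topologicalClosure.starProjection_apply_mem u) y
    rw [← comp_apply, hCQ, ← adjoint_inner_right, ← hu, inner_self_eq_norm_sq] at h1
    have h2 := S.range.topologicalClosure.norm_starProjection_apply_le u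
    have h3 := mul_le_mul_of_nonneg_right h2 (norm_nonneg (S y))
    rcases (norm_nonneg u).eq_or_lt with h0 | h0
    · rw [← h0]; positivity
    · exact le_of_mul_le_mul_left (by nlinarith) h0
  obtain ⟨D, hD, hDS, -⟩ := exists_comp_eq_of_norm_le (adjoint C) S zero_le_one hCadj
  refine ⟨adjoint D, by simpa using hD, ?_⟩
  rw [← hCS, ← adjoint_adjoint C, ← hDS, adjoint_comp, hS.isSelfAdjoint.adjoint_eq]
  rfl

/-- (Douglas factorization of even perturbations.) Let `H` be a separable Hilbert space over
`𝕜 = ℝ` or `ℂ`, `P` a bounded positive operator on `H` and `K` a bounded operator on `H`.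
Then `P + K` and `P - K` are both positive iff `K = √P ∘ X ∘ √P` for some bounded
self-adjoint `X` with `‖X‖ ≤ 1` whose range is contained in the closure of the range of `P`.
(`sqrtP` denotes the unique positive square root of `P`.) -/
theorem stmt2 (𝕜 : Type*) [RCLike 𝕜] (H : Type*) [NormedAddCommGroup H]
    [InnerProductSpace 𝕜 H] [CompleteSpace H] [TopologicalSpace.SeparableSpace H]
    (P K sqrtP : H →L[𝕜] H) (hP : P.IsPositive)
    (hsqrt : sqrtP.IsPositive) (hsqrt2 : sqrtP ∘L sqrtP = P) :
    ((P + K).IsPositive ∧ (P - K).IsPositive) ↔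
      ∃ X : H →L[𝕜] H, IsSelfAdjoint X ∧ ‖X‖ ≤ 1 ∧
        Set.range (⇑X) ⊆ closure (Set.range (⇑P)) ∧ K = sqrtP ∘L X ∘L sqrtP := by
  subst hsqrt2
  have hSadj := hsqrt.isSelfAdjoint.adjoint_eq
  constructor
  · rintro ⟨hadd, hsub⟩
    obtain ⟨Y, hY, hK⟩ :=
      ContinuousLinearMap.exists_eq_comp_comp_of_isPositive_add_sub hsqrt hadd hsub
    have hKadj : K.adjoint = K := by
      have h := hadd.isSelfAdjoint.sub hP.isSelfAdjoint
      rw [add_sub_cancel_left] at h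
      exact h.adjoint_eq
    have hK' : K = sqrtP ∘L Y.adjoint ∘L sqrtP := by
      rw [← hKadj, hK]
      simp only [ContinuousLinearMap.adjoint_comp, hSadj]
      rfl
    set M := (sqrtP ∘L sqrtP).range.topologicalClosure
    set Q := M.starProjection
    have hQadj : IsSelfAdjoint Q := isSelfAdjoint_starProjection M
    have hQn : ‖Q‖ ≤ 1 := M.starProjection_norm_le
    have hQS : Q ∘L sqrtP = sqrtP := by
      ext x
      exact Submodule.starProjection_eq_self_iff.2 (hsqrt.mem_closure_range_comp_self x)
    have hSQ : sqrtP ∘L Q = sqrtP := by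
      have h := congrArg ContinuousLinearMap.adjoint hQS
      rwa [ContinuousLinearMap.adjoint_comp, hSadj, hQadj.adjoint_eq] at h
    set Z : H →L[𝕜] H := (2⁻¹ : 𝕜) • (Y + Y.adjoint) with hZ
    have hZadj : IsSelfAdjoint Z := by
      refine IsSelfAdjoint.smul ?_ (IsSelfAdjoint.add_star_self Y)
      simp [isSelfAdjoint_iff]
    have hZn : ‖Z‖ ≤ 1 := by
      have h1 : ‖Y + Y.adjoint‖ ≤ 2 := by
        refine (norm_add_le _ _).trans ?_
        rw [LinearIsometryEquiv.norm_map]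
        linarith
      rw [hZ, norm_smul, norm_inv, RCLike.norm_ofNat]
      linarith
    refine ⟨Q ∘L Z ∘L Q, ?_, ?_, ?_, ?_⟩
    · have h := hZadj.conj_adjoint Q
      rwa [hQadj.adjoint_eq] at h
    · calc ‖Q ∘L Z ∘L Q‖ ≤ ‖Q‖ * (‖Z‖ * ‖Q‖) :=
            (Q.opNorm_comp_le _).trans
              (mul_le_mul_of_nonneg_left (Z.opNorm_comp_le Q) (norm_nonneg Q))
        _ ≤ 1 * (1 * 1) := by gcongr
        _ = 1 := by norm_num
    · rintro _ ⟨x, rfl⟩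
      exact M.starProjection_apply_mem (Z (Q x))
    · have h : sqrtP ∘L (Q ∘L Z ∘L Q) ∘L sqrtP = (sqrtP ∘L Q) ∘L Z ∘L (Q ∘L sqrtP) := rfl
      rw [h, hQS, hSQ, hZ, ContinuousLinearMap.smul_comp, ContinuousLinearMap.comp_smul,
        ContinuousLinearMap.add_comp, ContinuousLinearMap.comp_add, ← hK, ← hK', ← two_smul 𝕜 K,
        smul_smul, inv_mul_cancel₀ two_ne_zero, one_smul]
  · rintro ⟨X, hX, hXn, -, rfl⟩
    have hpos : ∀ T : H →L[𝕜] H, IsSelfAdjoint T → ‖T‖ ≤ 1 →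
        (sqrtP ∘L sqrtP + sqrtP ∘L T ∘L sqrtP).IsPositive := by
      intro T hT hTn
      have h1 : (1 + T).IsPositive := by
        refine ContinuousLinearMap.isPositive_def'.2 ⟨(IsSelfAdjoint.one _).add hT, fun x ↦ ?_⟩
        have hle : ‖T x‖ ≤ ‖x‖ := by simpa using T.le_of_opNorm_le hTn x
        have habs := (abs_le.1 ((RCLike.abs_re_le_norm _).trans
          (norm_inner_le_norm (𝕜 := 𝕜) (T x) x))).1
        have hmul := mul_le_mul_of_nonneg_right hle (norm_nonneg x)
        rw [ContinuousLinearMap.reApplyInnerSelf, add_apply, inner_add_left,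
          map_add, one_apply_eq_self, inner_self_eq_norm_mul_norm]
        linarith
      have h2 := h1.conj_adjoint sqrtP
      rw [hSadj, ContinuousLinearMap.add_comp, ContinuousLinearMap.comp_add] at h2
      exact h2
    refine ⟨hpos X hX hXn, ?_⟩
    have h := hpos (-X) hX.neg (by rwa [norm_neg])
    rwa [ContinuousLinearMap.neg_comp, ContinuousLinearMap.comp_neg, ← sub_eq_add_neg] at h
end
end

section
/- (Extreme correlation matrices, real case.) Let C be the convex set of real n × n correlation matrices, i.e., real positive semi-definite matrices P with P_{ii} = 1 for all i = 1, …, n. Then P ∈ C is an extreme point of C if and only if rank(P ⊙ P) = r(r+1)/2, where r = rank P and P ⊙ P is the Hadamard (entrywise) square of P. -/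
noncomputable section

/-- `v` is an *extreme point* of `C` if `v ∈ C` and there are no distinct `p₁, p₂ ∈ C`
and `α ∈ (0,1)` with `v = α • p₁ + (1 - α) • p₂`. -/
def IsExtremePt (𝕜 : Type*) [RCLike 𝕜] {V : Type*} [AddCommGroup V] [Module 𝕜 V]
    (C : Set V) (v : V) : Prop :=
  v ∈ C ∧ ¬ ∃ p₁ ∈ C, ∃ p₂ ∈ C, p₁ ≠ p₂ ∧ ∃ α : ℝ, 0 < α ∧ α < 1 ∧
      v = (α : 𝕜) • p₁ + ((1 - α : ℝ) : 𝕜) • p₂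

open Matrix in
/-- A real positive semi-definite matrix `P` is `B * Bᵀ` for a left-invertible matrix `B` with
`rank P` columns. -/
theorem Matrix.PosSemidef.exists_mul_transpose_of_leftInverse {ι : Type*} [Fintype ι]
    [DecidableEq ι] {P : Matrix ι ι ℝ} (hP : P.PosSemidef) :
    ∃ (B : Matrix ι (Fin P.rank) ℝ) (L : Matrix (Fin P.rank) ι ℝ), L * B = 1 ∧ P = B * Bᵀ := by
  classical
  have hA := hP.isHermitian
  let U : Matrix ι ι ℝ := (hA.eigenvectorUnitary : Matrix.unitaryGroup ι ℝ).1
  have hUU : Uᵀ * U = 1 := by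
    have := Unitary.coe_star_mul_self hA.eigenvectorUnitary
    rwa [star_eq_conjTranspose, conjTranspose_eq_transpose_of_trivial] at this
  have hspec : P = U * diagonal hA.eigenvalues * Uᵀ := by
    have := hA.spectral_theorem
    rw [Unitary.conjStarAlgAut_apply, star_eq_conjTranspose,
      conjTranspose_eq_transpose_of_trivial] at this
    exact this
  let e : Fin P.rank ≃ {i // hA.eigenvalues i ≠ 0} :=
    (finCongr hA.rank_eq_card_non_zero_eigs).trans (Fintype.equivFin _).symm
  have hpos : ∀ j, 0 < hA.eigenvalues (e j) := fun j =>
    lt_of_le_of_ne (hP.eigenvalues_nonneg _) (e j).2.symm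
  refine ⟨of fun i j => U i (e j) * √(hA.eigenvalues (e j)),
    of fun j i => U i (e j) / √(hA.eigenvalues (e j)), ?_, ?_⟩
  · ext j k
    have h := congrFun (congrFun hUU (e j)) (e k)
    simp only [mul_apply, transpose_apply, one_apply, of_apply, Subtype.coe_inj,
      e.injective.eq_iff] at h ⊢
    have hj := (Real.sqrt_pos.2 (hpos j)).ne'
    calc _ = (∑ x, U x (e j) * U x (e k)) * (√(hA.eigenvalues (e k)) / √(hA.eigenvalues (e j))) := by
          rw [Finset.sum_mul]; exact Finset.sum_congr rfl fun x _ => by ring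
      _ = _ := by
          rw [h]
          split_ifs with hjk
          · subst hjk; simp [hj]
          · simp
  · ext i k
    have h := congrFun (congrFun hspec i) k
    rw [h, mul_apply, mul_apply]
    simp only [mul_diagonal, transpose_apply, of_apply]
    rw [Equiv.sum_comp e fun x => U i x * √(hA.eigenvalues x) * (U k x * √(hA.eigenvalues x)),
      ← Finset.sum_subtype (Finset.univ.filter fun x => hA.eigenvalues x ≠ 0) (by simp)
        fun x => U i x * √(hA.eigenvalues x) * (U k x * √(hA.eigenvalues x)),
      Finset.sum_filter_of_ne]
    · refine Finset.sum_congr rfl fun x _ => ?_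
      linear_combination -(U i x * U k x) * Real.mul_self_sqrt (hP.eigenvalues_nonneg x)
    · rintro x - hx h0
      simp [h0] at hx

open Matrix in
/-- The quadratic form of a real matrix is bounded by the sum of the absolute values of its
entries. -/
theorem Matrix.abs_dotProduct_mulVec_le {κ : Type*} [Fintype κ] (H : Matrix κ κ ℝ) (x : κ → ℝ) :
    |x ⬝ᵥ H *ᵥ x| ≤ (∑ i, ∑ j, |H i j|) * (x ⬝ᵥ x) := by
  have hle : ∀ i, x i * x i ≤ x ⬝ᵥ x := fun i =>
    Finset.single_le_sum (f := fun i => x i * x i) (fun i _ => mul_self_nonneg _)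
      (Finset.mem_univ i)
  have hxy : ∀ i j, |x i * x j| ≤ x ⬝ᵥ x := fun i j => by
    rw [abs_le]
    constructor <;> nlinarith [hle i, hle j, mul_self_nonneg (x i + x j), mul_self_nonneg (x i - x j)]
  have hsum : x ⬝ᵥ H *ᵥ x = ∑ i, ∑ j, H i j * (x i * x j) := by
    simp only [dotProduct, mulVec, Finset.mul_sum]
    exact Finset.sum_congr rfl fun i _ => Finset.sum_congr rfl fun j _ => by ring
  rw [hsum, Finset.sum_mul]
  refine (Finset.abs_sum_le_sum_abs _ _).trans (Finset.sum_le_sum fun i _ => ?_)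
  rw [Finset.sum_mul]
  refine (Finset.abs_sum_le_sum_abs _ _).trans (Finset.sum_le_sum fun j _ => ?_)
  rw [abs_mul]
  exact mul_le_mul_of_nonneg_left (hxy i j) (abs_nonneg _)

open Matrix in
/-- A small symmetric perturbation of the identity matrix is positive semi-definite. -/
theorem Matrix.posSemidef_one_add_smul {κ : Type*} [Fintype κ] [DecidableEq κ] {H : Matrix κ κ ℝ}
    (hH : Hᵀ = H) {t : ℝ} (ht : |t| * ∑ i, ∑ j, |H i j| ≤ 1) : (1 + t • H).PosSemidef := by
  refine PosSemidef.of_dotProduct_mulVec_nonneg ?_ fun x => ?_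
  · rw [IsHermitian, conjTranspose_eq_transpose_of_trivial]
    simp [hH]
  · have hx : 0 ≤ x ⬝ᵥ x := Finset.sum_nonneg fun i _ => mul_self_nonneg _
    have h1 : |t * (x ⬝ᵥ H *ᵥ x)| ≤ x ⬝ᵥ x := by
      rw [abs_mul]
      calc _ ≤ |t| * ((∑ i, ∑ j, |H i j|) * (x ⬝ᵥ x)) :=
            mul_le_mul_of_nonneg_left (abs_dotProduct_mulVec_le H x) (abs_nonneg _)
        _ ≤ _ := by
            rw [← mul_assoc]
            exact mul_le_of_le_one_left hx ht
    simp only [star_trivial, add_mulVec, one_mulVec, smul_mulVec, dotProduct_add, dotProduct_smul,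
      smul_eq_mul]
    linarith [neg_abs_le (t * (x ⬝ᵥ H *ᵥ x))]

open Matrix in
/-- The kernel of a proper convex combination of two real positive semi-definite matrices is
contained in the kernel of the first one. -/
theorem Matrix.PosSemidef.mul_eq_zero_of_convexCombination {ι κ : Type*} [Fintype ι]
    {A B : Matrix ι ι ℝ} (hA : A.PosSemidef) (hB : B.PosSemidef) {a b : ℝ} (ha : 0 < a)
    (hb : 0 < b) {N : Matrix ι κ ℝ} (hN : (a • A + b • B) * N = 0) : A * N = 0 := by
  classical
  ext i k
  have hx : (a • A + b • B) *ᵥ (fun i => N i k) = 0 := by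
    ext i; exact congrFun (congrFun hN i) k
  have hq := congrArg (fun v => (fun i => N i k) ⬝ᵥ v) hx
  simp only [add_mulVec, smul_mulVec, dotProduct_add, dotProduct_smul, smul_eq_mul,
    dotProduct_zero] at hq
  have h1 := hA.dotProduct_mulVec_nonneg (fun i => N i k)
  have h2 := hB.dotProduct_mulVec_nonneg (fun i => N i k)
  have h3 := hA.dotProduct_mulVec_zero_iff (fun i => N i k)
  simp only [star_trivial] at h1 h2 h3
  exact congrFun (h3.1 (by nlinarith [mul_nonneg hb.le h2, mul_nonneg ha.le h1])) i

open Matrix in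
/-- A correlation matrix `B * Bᵀ` with `B` left-invertible is extreme iff the rank-one matrices
`bᵢᵀ bᵢ` built from the rows `bᵢ` of `B` have trivial orthogonal complement among the symmetric
matrices. -/
theorem isExtremePt_correlation_iff {ι κ : Type*} [Fintype ι] [DecidableEq ι] [Fintype κ]
    [DecidableEq κ] {B : Matrix ι κ ℝ} {L : Matrix κ ι ℝ} (hLB : L * B = 1)
    (hdiag : ∀ i, (B * Bᵀ) i i = 1) :
    IsExtremePt ℝ {P : Matrix ι ι ℝ | P.PosSemidef ∧ ∀ i, P i i = 1} (B * Bᵀ) ↔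
      ∀ H : Matrix κ κ ℝ, Hᵀ = H → (∀ i, (B * H * Bᵀ) i i = 0) → H = 0 := by
  have hBL : Bᵀ * Lᵀ = 1 := by rw [← transpose_mul, hLB, transpose_one]
  constructor
  · rintro ⟨-, hext⟩ H hH h0
    by_contra hne
    set c := ∑ i, ∑ j, |H i j|
    have hc0 : 0 ≤ c := Finset.sum_nonneg fun i _ => Finset.sum_nonneg fun j _ => abs_nonneg _
    have hexp : ∀ t : ℝ, B * (1 + t • H) * Bᵀ = B * Bᵀ + t • (B * H * Bᵀ) := fun t => by
      simp [Matrix.mul_add, Matrix.add_mul]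
    have hmem : ∀ t : ℝ, |t| * c ≤ 1 → B * Bᵀ + t • (B * H * Bᵀ) ∈
        {P : Matrix ι ι ℝ | P.PosSemidef ∧ ∀ i, P i i = 1} := fun t ht => by
      refine ⟨?_, fun i => by rw [Matrix.add_apply, Matrix.smul_apply, h0, hdiag]; simp⟩
      rw [← hexp, ← conjTranspose_eq_transpose_of_trivial B]
      exact (posSemidef_one_add_smul hH ht).mul_mul_conjTranspose_same B
    set ε := (c + 1)⁻¹ with hε
    have hε0 : 0 < ε := by positivity
    have hεc : |ε| * c ≤ 1 := by
      rw [abs_of_pos hε0, hε, inv_mul_le_iff₀ (by positivity)]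
      linarith
    refine hext ⟨_, hmem ε hεc, _, hmem (-ε) (by rwa [abs_neg]), fun h => hne ?_, 1 / 2,
      by norm_num, by norm_num, ?_⟩
    · have h2 : (2 * ε) • (B * H * Bᵀ) = 0 := by
        rw [neg_smul] at h
        rw [two_mul, add_smul]
        nth_rewrite 1 [add_left_cancel h]
        exact neg_add_cancel _
      have h3 : B * H * Bᵀ = 0 := (smul_eq_zero.1 h2).resolve_left (by positivity)
      calc H = L * B * H * (Bᵀ * Lᵀ) := by rw [hLB, hBL, Matrix.one_mul, Matrix.mul_one]
        _ = L * (B * H * Bᵀ) * Lᵀ := by simp only [Matrix.mul_assoc]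
        _ = 0 := by rw [h3, Matrix.mul_zero, Matrix.zero_mul]
    · ext i j
      simp only [Matrix.add_apply, Matrix.smul_apply, smul_eq_mul, RCLike.ofReal_real_eq_id, id]
      ring
  · intro hH
    refine ⟨⟨?_, hdiag⟩, ?_⟩
    · rw [← conjTranspose_eq_transpose_of_trivial B]
      exact posSemidef_self_mul_conjTranspose B
    rintro ⟨p, ⟨hp, hp1⟩, q, ⟨hq, hq1⟩, hne, α, h0, h1, heq⟩
    simp only [RCLike.ofReal_real_eq_id, id] at heq
    have hN : (B * Bᵀ) * (1 - Lᵀ * Bᵀ) = 0 := by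
      rw [Matrix.mul_sub, Matrix.mul_one, Matrix.mul_assoc, ← Matrix.mul_assoc Bᵀ, hBL,
        Matrix.one_mul, sub_self]
    have hpN := hp.mul_eq_zero_of_convexCombination hq h0 (sub_pos.2 h1) (heq ▸ hN)
    have hqN := hq.mul_eq_zero_of_convexCombination hp (sub_pos.2 h1) h0
      ((add_comm _ _).trans heq.symm ▸ hN)
    set D := p - q with hD
    have hDt : Dᵀ = D := by
      rw [hD, transpose_sub, ← conjTranspose_eq_transpose_of_trivial p,
        ← conjTranspose_eq_transpose_of_trivial q, hp.isHermitian.eq, hq.isHermitian.eq]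
    have hDN : D = D * (Lᵀ * Bᵀ) := by
      have : D * (1 - Lᵀ * Bᵀ) = 0 := by rw [hD, Matrix.sub_mul, hpN, hqN, sub_zero]
      rwa [Matrix.mul_sub, Matrix.mul_one, sub_eq_zero] at this
    have hDN' : D = B * L * D := by
      have := congrArg transpose hDN
      simpa only [transpose_mul, transpose_transpose, hDt] using this
    have hfac : B * (L * D * Lᵀ) * Bᵀ = D := by
      calc B * (L * D * Lᵀ) * Bᵀ = (B * L * D) * (Lᵀ * Bᵀ) := by simp only [Matrix.mul_assoc]
        _ = D := by rw [← hDN', ← hDN]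
    have hz := hH (L * D * Lᵀ) (by simp [hDt, Matrix.mul_assoc])
      (fun i => by rw [hfac, hD, Matrix.sub_apply, hp1, hq1, sub_self])
    rw [hz, Matrix.mul_zero, Matrix.zero_mul] at hfac
    exact hne (sub_eq_zero.1 hfac.symm)

/-- A real matrix has full column rank iff its kernel is trivial. -/
theorem Matrix.rank_eq_card_iff_mulVec {ι σ : Type*} [Fintype ι] [Fintype σ] (M : Matrix ι σ ℝ) :
    M.rank = Fintype.card σ ↔ ∀ x, M.mulVec x = 0 → x = 0 := by
  have h := M.mulVecLin.finrank_range_add_finrank_ker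
  rw [Module.finrank_fintype_fun_eq_card] at h
  have h2 : (∀ x, M.mulVec x = 0 → x = 0) ↔ Module.finrank ℝ M.mulVecLin.ker = 0 := by
    rw [Submodule.finrank_eq_zero, LinearMap.ker_eq_bot']
    rfl
  rw [h2, Matrix.rank]
  omega

open Matrix in
/-- The Hadamard square of a Gram matrix has full rank `k (k + 1) / 2` iff no nonzero symmetric
matrix is orthogonal to all the rank-one matrices built from the rows. -/
theorem rank_hadamard_gram_iff {ι : Type*} [Fintype ι] [DecidableEq ι] {k : ℕ}
    (B : Matrix ι (Fin k) ℝ) :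
    2 * ((B * Bᵀ) ⊙ (B * Bᵀ)).rank = k * (k + 1) ↔
      ∀ H : Matrix (Fin k) (Fin k) ℝ, Hᵀ = H → (∀ i, (B * H * Bᵀ) i i = 0) → H = 0 := by
  let g : Fin k × Fin k → Sym2 (Fin k) := fun p => Sym2.mk p.1 p.2
  let N : Sym2 (Fin k) → ℝ := fun s => ((Finset.univ.filter fun p => g p = s).card : ℝ)
  have hNpos : ∀ s, 0 < N s := fun s => by
    induction s with
    | _ a b => exact Nat.cast_pos.2 (Finset.card_pos.2 ⟨(a, b), by simp [g]⟩)
  let f : ι → Sym2 (Fin k) → ℝ := fun i =>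
    Sym2.lift ⟨fun a b => B i a * B i b, fun a b => mul_comm _ _⟩
  have hsum : ∀ F : Sym2 (Fin k) → ℝ, ∑ s, N s * F s = ∑ a, ∑ b, F s(a, b) := fun F => by
    rw [← Fintype.sum_prod_type' (f := fun a b => F s(a, b)),
      ← Finset.sum_fiberwise Finset.univ g]
    refine Finset.sum_congr rfl fun s _ => ?_
    rw [Finset.sum_congr rfl (g := fun _ => F s), Finset.sum_const, nsmul_eq_mul]
    intro p hp
    rw [← (Finset.mem_filter.1 hp).2]
  let M : Matrix ι (Sym2 (Fin k)) ℝ := of fun i s => √(N s) * f i s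
  have hM : (B * Bᵀ) ⊙ (B * Bᵀ) = M * Mᵀ := by
    ext i j
    have : (M * Mᵀ) i j = ∑ s, N s * (f i s * f j s) := by
      simp only [mul_apply, transpose_apply, M, of_apply]
      refine Finset.sum_congr rfl fun s _ => ?_
      linear_combination (f i s * f j s) * Real.mul_self_sqrt (hNpos s).le
    rw [this, hsum, hadamard_apply, mul_apply, Finset.sum_mul_sum]
    refine Finset.sum_congr rfl fun a _ => Finset.sum_congr rfl fun b _ => ?_
    simp only [f, Sym2.lift_mk, transpose_apply]
    ring
  have hMx : ∀ x i, (M *ᵥ x) i = ∑ a, ∑ b, (x s(a, b) / √(N s(a, b))) * (B i a * B i b) := by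
    intro x i
    refine Eq.trans ?_ (hsum fun s => (x s / √(N s)) * f i s)
    simp only [mulVec, dotProduct, M, of_apply]
    refine Finset.sum_congr rfl fun s _ => ?_
    have := (Real.sqrt_pos.2 (hNpos s)).ne'
    field_simp
    rw [Real.sq_sqrt (hNpos s).le]
    ring
  have hBH : ∀ (H : Matrix (Fin k) (Fin k) ℝ) i,
      (B * H * Bᵀ) i i = ∑ a, ∑ b, H a b * (B i a * B i b) := fun H i => by
    simp only [mul_apply, transpose_apply, Finset.sum_mul]
    rw [Finset.sum_comm]
    exact Finset.sum_congr rfl fun a _ => Finset.sum_congr rfl fun b _ => by ring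
  have hcard : 2 * Fintype.card (Sym2 (Fin k)) = k * (k + 1) := by
    rw [Sym2.card, Fintype.card_fin, Nat.choose_two_right, Nat.add_sub_cancel, mul_comm (k + 1)]
    exact Nat.mul_div_cancel' (Nat.even_mul_succ_self k).two_dvd
  rw [hM, rank_self_mul_transpose, ← hcard, Nat.mul_right_inj two_ne_zero,
    rank_eq_card_iff_mulVec]
  constructor
  · intro h H hH h0
    have hsymm : ∀ a b, H a b = H b a := fun a b => congrFun (congrFun hH.symm a) b
    let y : Sym2 (Fin k) → ℝ := Sym2.lift ⟨fun a b => H a b, hsymm⟩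
    have hy := h (fun s => √(N s) * y s) <| by
      ext i
      rw [hMx, Pi.zero_apply, ← h0 i, hBH]
      refine Finset.sum_congr rfl fun a _ => Finset.sum_congr rfl fun b _ => ?_
      rw [mul_div_cancel_left₀ _ (Real.sqrt_pos.2 (hNpos _)).ne']
      rfl
    ext a b
    have := congrFun hy s(a, b)
    exact (mul_eq_zero.1 this).resolve_left (Real.sqrt_pos.2 (hNpos _)).ne'
  · intro h x hx
    have hH := h (of fun a b => x s(a, b) / √(N s(a, b)))
      (by ext a b; simp only [transpose_apply, of_apply, Sym2.eq_swap])
      (fun i => by rw [hBH, ← Pi.zero_apply (M := fun _ => ℝ) i, ← hx, hMx]; rfl)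
    ext s
    induction s with
    | _ a b =>
      have := congrFun (congrFun hH a) b
      exact (div_eq_zero_iff.1 this).resolve_right (Real.sqrt_pos.2 (hNpos _)).ne'

/-- (Extreme correlation matrices, real case.) Let `C` be the convex set of real `n × n`
correlation matrices (real positive semi-definite matrices with unit diagonal). Then `P ∈ C`
is an extreme point of `C` iff `rank (P ⊙ P) = r(r+1)/2` where `r = rank P` and `P ⊙ P` is
the Hadamard (entrywise) square of `P`. -/
theorem stmt16 (n : ℕ)
    (C : Set (Matrix (Fin n) (Fin n) ℝ))
    (hC : C = {P : Matrix (Fin n) (Fin n) ℝ | P.PosSemidef ∧ ∀ i, P i i = 1})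
    (P : Matrix (Fin n) (Fin n) ℝ) (hP : P ∈ C) :
    IsExtremePt ℝ C P ↔ 2 * (Matrix.hadamard P P).rank = P.rank * (P.rank + 1) := by
  subst hC
  obtain ⟨B, L, hLB, hPB⟩ := hP.1.exists_mul_transpose_of_leftInverse
  have hext := isExtremePt_correlation_iff hLB (hPB ▸ hP.2)
  have hrank := rank_hadamard_gram_iff B
  rw [← hPB] at hext hrank
  exact hext.trans hrank.symm
end
end
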